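/- For every complex number s with Re(s) > 1, the Dirichlet series ∑_{n ≥ 1} D(n)/n^s converges and equals ζ(s) · ζ(2s) · ∏_p (1 − 1/(2 p^{2s}) + 1/(2 p^{3s})), where ζ is the Riemann zeta function, the product runs over all primes p, and D(n) = d(n)/d*(n). -/

import Mathlib

open scoped Classical

noncomputable section

/-- Number of unitary divisors of `n`: divisors `e` of `n` with `gcd (e, n/e) = 1`. -/
def dstar (n : ℕ) : ℕ := (n.divisors.filter fun e => Nat.gcd e (n / e) = 1).card

/-- `D n = d(n) / d*(n)`, as a complex number. -/
def DC (n : ℕ) : ℂ := (n.divisors.card : ℂ) / (dstar n : ℂ)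

theorem dstar_mul_of_coprime {m n : ℕ} (h : m.Coprime n) (hm : m ≠ 0) (hn : n ≠ 0) :
    dstar (m * n) = dstar m * dstar n := by
  unfold dstar
  rw [← Finset.card_product]
  symm
  refine Finset.card_bij (fun x _ => x.1 * x.2) ?_ ?_ ?_
  · rintro ⟨e, f⟩ hx
    simp only [Finset.mem_product, Finset.mem_filter, Nat.mem_divisors] at hx ⊢
    obtain ⟨⟨⟨he, -⟩, he'⟩, ⟨hf, -⟩, hf'⟩ := hx
    refine ⟨⟨Nat.mul_dvd_mul he hf, Nat.mul_ne_zero hm hn⟩, ?_⟩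
    rw [← Nat.div_mul_div_comm he hf]
    exact Nat.Coprime.mul_left
      (Nat.Coprime.mul_right he' ((h.coprime_dvd_left he).coprime_dvd_right (Nat.div_dvd_of_dvd hf)))
      (Nat.Coprime.mul_right
        ((h.symm.coprime_dvd_left hf).coprime_dvd_right (Nat.div_dvd_of_dvd he)) hf')
  · rintro ⟨e, f⟩ hx ⟨e', f'⟩ hx' heq
    simp only [Finset.mem_product, Finset.mem_filter, Nat.mem_divisors] at hx hx' heq
    have gcd_left {a b : ℕ} (ha : a ∣ m) (hb : b ∣ n) : (a * b).gcd m = a := by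
      rw [Nat.Coprime.gcd_mul_right_cancel a (h.symm.coprime_dvd_left hb)]
      exact Nat.gcd_eq_left ha
    have gcd_right {a b : ℕ} (ha : a ∣ m) (hb : b ∣ n) : (a * b).gcd n = b := by
      rw [Nat.Coprime.gcd_mul_left_cancel b (h.coprime_dvd_left ha)]
      exact Nat.gcd_eq_left hb
    rw [Prod.mk.injEq]
    constructor
    · rw [← gcd_left hx.1.1.1 hx.2.1.1, heq, gcd_left hx'.1.1.1 hx'.2.1.1]
    · rw [← gcd_right hx.1.1.1 hx.2.1.1, heq, gcd_right hx'.1.1.1 hx'.2.1.1]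
  · intro d hd
    simp only [Finset.mem_filter, Nat.mem_divisors] at hd
    obtain ⟨⟨hd, -⟩, hd'⟩ := hd
    obtain ⟨e, f, he, hf, rfl⟩ := (Nat.dvd_mul).1 hd
    rw [← Nat.div_mul_div_comm he hf] at hd'
    refine ⟨(e, f), ?_, rfl⟩
    simp only [Finset.mem_product, Finset.mem_filter, Nat.mem_divisors]
    exact ⟨⟨⟨he, hm⟩, Nat.Coprime.coprime_mul_right (Nat.Coprime.coprime_mul_right_right hd')⟩,
      ⟨hf, hn⟩, Nat.Coprime.coprime_mul_left (Nat.Coprime.coprime_mul_left_right hd')⟩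

theorem dstar_prime_pow {p k : ℕ} (hp : p.Prime) (hk : k ≠ 0) : dstar (p ^ k) = 2 := by
  have hne : 1 ≠ p ^ k := (Nat.one_lt_pow hk hp.one_lt).ne
  rw [dstar, ← Finset.card_pair hne]
  congr 1
  ext d
  simp only [Finset.mem_filter, Nat.mem_divisors, Finset.mem_insert, Finset.mem_singleton]
  constructor
  · rintro ⟨⟨hd, -⟩, hg⟩
    obtain ⟨i, hi, rfl⟩ := (Nat.dvd_prime_pow hp).1 hd
    rw [Nat.pow_div hi hp.pos] at hg
    rcases Nat.eq_zero_or_pos i with rfl | hi0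
    · simp
    · right
      congr 1
      by_contra hlt
      have := (Nat.coprime_pow_left_iff hi0 _ _).1 hg
      have := (Nat.coprime_pow_right_iff (by omega) _ _).1 this
      exact hp.one_lt.ne' ((Nat.coprime_self p).1 this)
  · have hpk : p ^ k ≠ 0 := pow_ne_zero _ hp.ne_zero
    rintro (rfl | rfl)
    · simp [hp.ne_zero]
    · simp [hp.ne_zero, Nat.div_self (Nat.pos_of_ne_zero hpk)]

theorem DC_zero : DC 0 = 0 := by simp [DC]

theorem DC_one : DC 1 = 1 := by simp [DC, dstar, Finset.filter_singleton]

theorem DC_mul_of_coprime {m n : ℕ} (h : m.Coprime n) : DC (m * n) = DC m * DC n := by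
  rcases eq_or_ne m 0 with rfl | hm
  · simp [DC_zero]
  rcases eq_or_ne n 0 with rfl | hn
  · simp [DC_zero]
  simp only [DC, dstar_mul_of_coprime h hm hn, h.card_divisors_mul, Nat.cast_mul]
  exact mul_div_mul_comm _ _ _ _

theorem DC_prime_pow {p k : ℕ} (hp : p.Prime) (hk : k ≠ 0) : DC (p ^ k) = (k + 1) / 2 := by
  simp [DC, dstar_prime_pow hp hk, Nat.divisors_prime_pow hp]

theorem norm_DC_le (n : ℕ) : ‖DC n‖ ≤ n.divisors.card := by
  rw [DC, norm_div, Complex.norm_natCast, Complex.norm_natCast]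
  rcases Nat.eq_zero_or_pos (dstar n) with h | h
  · simp [h]
  · exact div_le_self (Nat.cast_nonneg _) (by exact_mod_cast h)

theorem LSeriesSummable_DC {s : ℂ} (hs : 1 < s.re) : LSeriesSummable DC s := by
  have hζ := ArithmeticFunction.LSeriesSummable_zeta_iff.2 hs
  have h := LSeriesSummable.convolution hζ hζ
  refine .of_norm <| h.norm.of_nonneg_of_le (fun _ ↦ norm_nonneg _) fun n ↦ LSeries.norm_term_le s ?_
  refine (norm_DC_le n).trans_eq ?_
  rw [LSeries.convolution_def]
  have key : ∑ x ∈ n.divisorsAntidiagonal, ((ArithmeticFunction.zeta x.1 : ℕ) : ℂ) *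
      ((ArithmeticFunction.zeta x.2 : ℕ) : ℂ) = (n.divisors.card : ℂ) := by
    rw [Finset.sum_congr rfl (g := fun _ => (1 : ℂ)), Finset.sum_const, nsmul_one,
      ← Nat.map_div_right_divisors, Finset.card_map]
    intro x hx
    have := Nat.mem_divisorsAntidiagonal.1 hx
    have h1 : x.1 ≠ 0 := fun h => this.2 (by simp [← this.1, h])
    have h2 : x.2 ≠ 0 := fun h => this.2 (by simp [← this.1, h])
    simp [ArithmeticFunction.zeta_apply, h1, h2]
  simp only
  rw [key, Complex.norm_natCast]

theorem hasSum_eulerFactor {x : ℂ} (hx : ‖x‖ < 1) {p : ℕ} (hp : p.Prime) :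
    HasSum (fun e : ℕ => DC (p ^ e) * x ^ e)
      ((1 - x)⁻¹ * (1 - x ^ 2)⁻¹ * (1 - x ^ 2 / 2 + x ^ 3 / 2)) := by
  have h0 : HasSum (fun e : ℕ => if e = 0 then (1 / 2 : ℂ) else 0) (1 / 2) :=
    hasSum_ite_eq 0 _
  have h := h0.add (((hasSum_coe_mul_geometric_of_norm_lt_one hx).add
    (hasSum_geometric_of_norm_lt_one hx)).mul_left (1 / 2))
  convert! h using 1
  · ext e
    rcases eq_or_ne e 0 with rfl | he
    · simp [DC_one]; norm_num
    · simp only [DC_prime_pow hp he, he, if_false]; ring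
  · have h1 : 1 - x ≠ 0 := fun h => by
      rw [← sub_eq_zero.1 h] at hx; simp at hx
    have h2 : 1 + x ≠ 0 := fun h => by
      rw [eq_neg_of_add_eq_zero_right h] at hx; simp at hx
    rw [show 1 - x ^ 2 = (1 - x) * (1 + x) by ring]
    field_simp
    ring

theorem norm_prime_cpow_neg_lt_one (p : Nat.Primes) {z : ℂ} (hz : 1 < z.re) :
    ‖(p : ℂ) ^ (-z)‖ < 1 := by
  rw [Complex.norm_natCast_cpow_of_pos p.prop.pos]
  exact Real.rpow_lt_one_of_one_lt_of_neg (mod_cast p.prop.one_lt) (by simp; linarith)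

theorem dirichlet_series_DD (s : ℂ) (hs : 1 < s.re) :
    HasSum (fun n : ℕ+ => DC n / (n : ℂ) ^ s)
      (riemannZeta s * riemannZeta (2 * s) *
        ∏' p : Nat.Primes, (1 - 1 / (2 * (p : ℂ) ^ (2 * s)) + 1 / (2 * (p : ℂ) ^ (3 * s)))) := by
  have hs2 : 1 < (2 * s).re := by simp; linarith
  set f : ℕ → ℂ := fun n => DC n / (n : ℂ) ^ s with hf
  have hterm : LSeries.term DC s = f := by
    ext n
    rcases eq_or_ne n 0 with rfl | hn
    · simp [hf, DC_zero]
    · simp [hf, LSeries.term_of_ne_zero hn]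
  have hsum : Summable f := hterm ▸ LSeriesSummable_DC hs
  have hmul {m n : ℕ} (h : m.Coprime n) : f (m * n) = f m * f n := by
    simp only [hf, DC_mul_of_coprime h, Nat.cast_mul, Complex.natCast_mul_natCast_cpow]
    exact mul_div_mul_comm _ _ _ _
  have hF := EulerProduct.eulerProduct_hasProd (f := f) (by simp [hf, DC_one]) hmul
    hsum.norm (by simp [hf, DC_zero])
  have hfactor (p : Nat.Primes) : ∑' e, f ((p : ℕ) ^ e) =
      (1 - (p : ℂ) ^ (-s))⁻¹ * (1 - (p : ℂ) ^ (-(2 * s)))⁻¹ *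
        (1 - 1 / (2 * (p : ℂ) ^ (2 * s)) + 1 / (2 * (p : ℂ) ^ (3 * s))) := by
    have hx := norm_prime_cpow_neg_lt_one p hs
    have hpow (k : ℕ) : ((p : ℂ) ^ (-s)) ^ k = ((p : ℂ) ^ (k * s))⁻¹ := by
      rw [← Complex.cpow_nat_mul, ← Complex.cpow_neg]; ring_nf
    convert! (hasSum_eulerFactor hx p.prop).tsum_eq using 1
    · refine tsum_congr fun e => ?_
      rw [hpow, hf]
      simp only [Nat.cast_pow]
      rw [div_eq_mul_inv, Complex.natCast_cpow_natCast_mul]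
    · rw [hpow, hpow, Complex.cpow_neg _ (2 * s)]
      push_cast
      ring
  simp only [hfactor] at hF
  have hZ := (riemannZeta_eulerProduct_hasProd hs).mul (riemannZeta_eulerProduct_hasProd hs2)
  have hne : riemannZeta s * riemannZeta (2 * s) ≠ 0 :=
    mul_ne_zero (riemannZeta_ne_zero_of_one_lt_re hs) (riemannZeta_ne_zero_of_one_lt_re hs2)
  have hG := hF.div₀ hZ hne
  have hfac (p : Nat.Primes) {z : ℂ} (hz : 1 < z.re) : (1 - (p : ℂ) ^ (-z))⁻¹ ≠ 0 := by
    refine inv_ne_zero fun h => ?_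
    have hx := norm_prime_cpow_neg_lt_one p hz
    rw [← sub_eq_zero.1 h] at hx
    simp at hx
  simp only [mul_div_cancel_left₀ _ (mul_ne_zero (hfac _ hs) (hfac _ hs2))] at hG
  rw [hG.tprod_eq, mul_div_cancel₀ _ hne]
  refine (Function.Injective.hasSum_iff PNat.coe_injective ?_).2 hsum.hasSum
  intro n hn
  rcases Nat.eq_zero_or_pos n with rfl | h
  · simp [hf, DC_zero]
  · exact absurd ⟨⟨n, h⟩, rfl⟩ hn
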